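/- Let T > 0 and let (Ω, 𝓕, (𝓕_t)_{t∈[0,T]}, P) be a filtered probability space. Let Δ : [0,T] × Ω → ℝ be progressively measurable with E[∫₀^T Δ_s² ds] < ∞, and let C₀ ≥ 0 be a constant. Suppose that for every pair 0 ≤ a ≤ b ≤ T there exists a measurable process ξ^{a,b} : [a,b] × Ω → ℝ with E[∫_a^b (ξ^{a,b}_s)² ds] < ∞ such that: (i) for every s ∈ [a,b], E[(ξ^{a,b}_s − 1)² | 𝓕_a] ≤ C₀((s−a) + (s−a)²) almost surely, and (ii) E[∫_a^b ξ^{a,b}_s Δ_s ds | 𝓕_a] ≤ 0 almost surely. Then for every 0 ≤ t ≤ t+δ ≤ T one has E[∫_t^{t+δ} Δ_s ds | 𝓕_t] ≤ 0 almost surely. -/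

import Mathlib

open MeasureTheory Set

/-- A real function whose increments are bounded above by a multiple of the squared step does not
increase. -/
lemma le_of_forall_sub_le_mul_sq {φ : ℝ → ℝ} {p q K : ℝ} (hpq : p ≤ q)
    (h : ∀ a b, p ≤ a → a ≤ b → b ≤ q → φ b - φ a ≤ K * (b - a) ^ 2) : φ q ≤ φ p := by
  have hn (n : ℕ) (hn : 0 < n) : φ q - φ p ≤ K * (q - p) ^ 2 / n := by
    have hn' : (0 : ℝ) < n := by exact_mod_cast hn
    set c : ℕ → ℝ := fun k => p + k * ((q - p) / n) with hc
    have hstep : 0 ≤ (q - p) / n := div_nonneg (by linarith) hn'.le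
    have hc0 : c 0 = p := by simp [hc]
    have hcn : c n = q := by simp only [hc]; field_simp; ring
    have hcsucc (k : ℕ) : c (k + 1) - c k = (q - p) / n := by simp only [hc]; push_cast; ring
    have hmono : Monotone c := monotone_nat_of_le_succ fun k => by linarith [hcsucc k]
    calc φ q - φ p = ∑ k ∈ Finset.range n, (φ (c (k + 1)) - φ (c k)) := by
          rw [Finset.sum_range_sub (fun k => φ (c k)), hc0, hcn]
      _ ≤ ∑ _k ∈ Finset.range n, K * ((q - p) / n) ^ 2 := by
          refine Finset.sum_le_sum fun k hk => ?_
          rw [← hcsucc k]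
          refine h _ _ (hc0 ▸ hmono (Nat.zero_le k)) (hmono (Nat.le_succ k)) ?_
          exact hcn ▸ hmono (Finset.mem_range.mp hk)
      _ = K * (q - p) ^ 2 / n := by
          simp only [Finset.sum_const, Finset.card_range, nsmul_eq_mul]
          field_simp
  have hlim : Filter.Tendsto (fun n : ℕ => K * (q - p) ^ 2 / n) Filter.atTop (nhds 0) :=
    tendsto_const_div_atTop_nhds_zero_nat _
  have := ge_of_tendsto hlim (Filter.eventually_atTop.mpr ⟨1, fun n h1 => hn n h1⟩)
  linarith

section

variable {Ω : Type*} {m' m : MeasurableSpace Ω} {P : Measure Ω}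

/-- A conditional expectation is a.e. nonpositive if its integrand has nonpositive integral over
every conditioning event. -/
lemma condExp_nonpos_of_forall_setIntegral_nonpos [IsFiniteMeasure P]
    (hm : m' ≤ m) {X : Ω → ℝ} (hX : Integrable X P)
    (h : ∀ A, MeasurableSet[m'] A → ∫ ω in A, X ω ∂P ≤ 0) :
    ∀ᵐ ω ∂P, (P[X|m']) ω ≤ 0 := by
  refine ae_of_ae_trim hm ?_
  have hInt : Integrable (fun ω => -(P[X|m']) ω) (P.trim hm) :=
    (integrable_condExp.trim hm stronglyMeasurable_condExp).neg
  have := ae_nonneg_of_forall_setIntegral_nonneg hInt fun A hA _ => by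
    rw [integral_neg, ← setIntegral_trim hm stronglyMeasurable_condExp hA,
      setIntegral_condExp hm hX hA]
    linarith [h A hA]
  filter_upwards [this] with ω hω
  simpa using hω

lemma memLp_two_uncurry_of_lintegral_lt_top [IsFiniteMeasure P] {f : ℝ → Ω → ℝ} {a b : ℝ}
    (hf : Measurable (Function.uncurry f))
    (h : ∫⁻ ω, (∫⁻ s in Icc a b, ENNReal.ofReal ((f s ω) ^ 2)) ∂P < ⊤) :
    MemLp (Function.uncurry f) 2 ((volume.restrict (Icc a b)).prod P) := by
  rw [memLp_two_iff_integrable_sq hf.aestronglyMeasurable]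
  refine ⟨(hf.pow_const 2).aestronglyMeasurable, ?_⟩
  rw [hasFiniteIntegral_iff_ofReal (Filter.Eventually.of_forall fun _ => sq_nonneg _),
    lintegral_prod_symm _ (hf.pow_const 2).ennreal_ofReal.aemeasurable]
  exact h

/-- On a short interval the integral of `Δ - ε Δ²` is controlled by the mean square distance of the
weight `ξ` from `1`. -/
lemma integral_sub_mul_sq_le [IsProbabilityMeasure P] (hm : m' ≤ m)
    {Δ ξ : ℝ → Ω → ℝ} {a b C ε : ℝ} (hab : a ≤ b) (hC : 0 ≤ C) (hε : 0 < ε)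
    (hΔ : MemLp (Function.uncurry Δ) 2 ((volume.restrict (Ioc a b)).prod P))
    (hξ : MemLp (Function.uncurry ξ) 2 ((volume.restrict (Ioc a b)).prod P))
    (hclose : ∀ s ∈ Ioc a b, ∀ᵐ ω ∂P,
      (P[fun ω' => (ξ s ω' - 1) ^ 2|m']) ω ≤ C * (s - a))
    (hneg : ∀ᵐ ω ∂P, (P[fun ω' => ∫ s in a..b, ξ s ω' * Δ s ω'|m']) ω ≤ 0)
    {A : Set Ω} (hA : MeasurableSet[m'] A) :
    ∫ z, (Function.uncurry Δ z - ε * Function.uncurry Δ z ^ 2)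
        ∂(volume.restrict (Ioc a b)).prod (P.restrict A) ≤ C / (4 * ε) * (b - a) ^ 2 := by
  set μ := volume.restrict (Ioc a b) with hμ
  have hle : μ.prod (P.restrict A) ≤ μ.prod P :=
    Measure.prod_mono le_rfl Measure.restrict_le_self
  have hprod : Integrable (fun z => Function.uncurry ξ z * Function.uncurry Δ z) (μ.prod P) :=
    hξ.integrable_mul hΔ
  have hsq : Integrable (fun z => (Function.uncurry ξ z - 1) ^ 2) (μ.prod P) :=
    (hξ.sub (memLp_const 1)).integrable_sq
  have hΔ1 : Integrable (Function.uncurry Δ) (μ.prod P) := hΔ.integrable one_le_two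
  have hweighted : ∫ z, Function.uncurry ξ z * Function.uncurry Δ z ∂μ.prod (P.restrict A) ≤ 0 := by
    rw [integral_prod_symm _ (hprod.mono_measure hle)]
    have hInt : Integrable (fun ω => ∫ s in a..b, ξ s ω * Δ s ω) P := by
      simpa only [intervalIntegral.integral_of_le hab] using! hprod.integral_prod_right
    have h1 := setIntegral_condExp hm hInt hA
    have h2 := integral_nonpos_of_ae (ae_restrict_of_ae (s := A) hneg)
    rw [h1] at h2
    simpa only [intervalIntegral.integral_of_le hab] using! h2
  have hdist : ∫ z, (Function.uncurry ξ z - 1) ^ 2 ∂μ.prod (P.restrict A) ≤ C * (b - a) ^ 2 := by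
    have hsqA := hsq.mono_measure hle
    rw [integral_prod _ hsqA]
    calc ∫ s, ∫ ω in A, (ξ s ω - 1) ^ 2 ∂P ∂μ ≤ ∫ _s, C * (b - a) ∂μ := by
          refine integral_mono_ae hsqA.integral_prod_left (integrable_const _) ?_
          filter_upwards [hsq.prod_right_ae, ae_restrict_mem measurableSet_Ioc] with s hs hsI
          have hs' : Integrable (fun ω => (ξ s ω - 1) ^ 2) P := hs
          show ∫ ω in A, (ξ s ω - 1) ^ 2 ∂P ≤ C * (b - a)
          have hCs : C * (s - a) ≤ C * (b - a) := by
            have := hsI.2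
            gcongr
          have h0 : 0 ≤ C * (b - a) := mul_nonneg hC (by linarith)
          rw [← setIntegral_condExp hm hs' hA]
          calc ∫ ω in A, (P[fun ω' => (ξ s ω' - 1) ^ 2|m']) ω ∂P
              ≤ ∫ _ω in A, C * (b - a) ∂P := by
                refine integral_mono_ae integrable_condExp.integrableOn (integrable_const _) ?_
                filter_upwards [ae_restrict_of_ae (hclose s hsI)] with ω hω
                exact hω.trans hCs
            _ ≤ C * (b - a) := by
                rw [integral_const, smul_eq_mul]
                exact mul_le_of_le_one_left h0
                  (by simpa [Measure.real] using! measureReal_le_one (μ := P) (s := A))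
      _ = C * (b - a) ^ 2 := by
          simp [hμ, hab]
          ring
  calc ∫ z, (Function.uncurry Δ z - ε * Function.uncurry Δ z ^ 2) ∂μ.prod (P.restrict A)
      ≤ ∫ z, (Function.uncurry ξ z * Function.uncurry Δ z
          + 1 / (4 * ε) * (Function.uncurry ξ z - 1) ^ 2) ∂μ.prod (P.restrict A) := by
        refine integral_mono (((hΔ1.sub (hΔ.integrable_sq.const_mul ε))).mono_measure hle)
          ((hprod.add (hsq.const_mul _)).mono_measure hle) fun z => ?_
        have hyoung (x d : ℝ) : d - ε * d ^ 2 ≤ x * d + 1 / (4 * ε) * (x - 1) ^ 2 := by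
          have h1 : 0 ≤ (2 * ε * d + (x - 1)) ^ 2 / (4 * ε) := by positivity
          have h2 : (2 * ε * d + (x - 1)) ^ 2 / (4 * ε)
              = x * d + 1 / (4 * ε) * (x - 1) ^ 2 - (d - ε * d ^ 2) := by
            field_simp
            ring
          linarith
        exact hyoung _ _
    _ = ∫ z, Function.uncurry ξ z * Function.uncurry Δ z ∂μ.prod (P.restrict A)
        + 1 / (4 * ε) * ∫ z, (Function.uncurry ξ z - 1) ^ 2 ∂μ.prod (P.restrict A) := by
        rw [integral_add (hprod.mono_measure hle) ((hsq.const_mul _).mono_measure hle),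
          integral_const_mul]
    _ ≤ 0 + 1 / (4 * ε) * (C * (b - a) ^ 2) := by gcongr
    _ = C / (4 * ε) * (b - a) ^ 2 := by ring

/-- A progressively measurable process agrees up to time `T` with a jointly measurable one. -/
lemma measurable_uncurry_stopped {ℱ : Filtration ℝ m} {Δ : ℝ → Ω → ℝ}
    (h : IsStronglyProgressive ℱ Δ) (T : ℝ) :
    Measurable (Function.uncurry fun s => Δ (min s T)) := by
  have h1 := (h T).measurable
  have h2 : Measurable[_, Subtype.instMeasurableSpace.prod (ℱ T)]
      fun z : ℝ × Ω => ((⟨min z.1 T, mem_Iic.mpr (min_le_right _ _)⟩ : Iic T), z.2) := by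
    refine @Measurable.prodMk _ _ _ _ _ (ℱ T) _ _ ?_ (measurable_snd.mono le_rfl (ℱ.le T))
    exact (measurable_fst.min measurable_const).subtype_mk
  exact h1.comp h2

end

/-- Key intermediate inequality (ineq_Q_expec): if for each subinterval `[a,b]` of `[0,T]`
there is a square-integrable weight `ξ` close to `1` near `a` (in conditional mean square)
with `E[∫_a^b ξ_s Δ_s ds | 𝓕_a] ≤ 0`, then `E[∫_t^{t+δ} Δ_s ds | 𝓕_t] ≤ 0`. -/
theorem stmt0
    {Ω : Type*} {m : MeasurableSpace Ω} (P : Measure Ω) [IsProbabilityMeasure P]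
    (T : ℝ) (hT : 0 < T) (ℱ : Filtration ℝ m)
    (Δ : ℝ → Ω → ℝ) (hΔprog : ProgMeasurable ℱ Δ)
    (hΔint : ∫⁻ ω, (∫⁻ s in Icc (0 : ℝ) T, ENNReal.ofReal ((Δ s ω) ^ 2)) ∂P < ⊤)
    (C₀ : ℝ) (hC₀ : 0 ≤ C₀)
    (hξ : ∀ a b : ℝ, 0 ≤ a → a ≤ b → b ≤ T →
      ∃ ξ : ℝ → Ω → ℝ, Measurable (Function.uncurry ξ) ∧
        (∫⁻ ω, (∫⁻ s in Icc a b, ENNReal.ofReal ((ξ s ω) ^ 2)) ∂P < ⊤) ∧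
        (∀ s ∈ Icc a b, ∀ᵐ ω ∂P,
          (P[fun ω' => (ξ s ω' - 1) ^ 2|ℱ a]) ω ≤ C₀ * ((s - a) + (s - a) ^ 2)) ∧
        (∀ᵐ ω ∂P, (P[fun ω' => ∫ s in a..b, ξ s ω' * Δ s ω'|ℱ a]) ω ≤ 0)) :
    ∀ t δ : ℝ, 0 ≤ t → 0 ≤ δ → t + δ ≤ T →
      ∀ᵐ ω ∂P, (P[fun ω' => ∫ s in t..(t + δ), Δ s ω'|ℱ t]) ω ≤ 0 := by
  intro t δ ht hδ htδ
  set D : ℝ → Ω → ℝ := fun s => Δ (min s T) with hD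
  have hDΔ {s : ℝ} (hs : s ≤ T) : Δ s = D s := by simp [hD, hs]
  have hDL2 : MemLp (Function.uncurry D) 2 ((volume.restrict (Icc 0 T)).prod P) := by
    refine memLp_two_uncurry_of_lintegral_lt_top (measurable_uncurry_stopped hΔprog T) ?_
    refine lt_of_eq_of_lt (lintegral_congr fun ω => ?_) hΔint
    exact setLIntegral_congr_fun measurableSet_Icc fun s hs => by simp only [hDΔ hs.2]
  have hDsub {a b : ℝ} (ha : 0 ≤ a) (hb : b ≤ T) :
      MemLp (Function.uncurry D) 2 ((volume.restrict (Ioc a b)).prod P) :=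
    hDL2.mono_measure <| Measure.prod_mono
      (Measure.restrict_mono (Ioc_subset_Icc_self.trans (Icc_subset_Icc ha hb)) le_rfl) le_rfl
  have htt : t ≤ t + δ := by linarith
  have hDt := hDsub ht htδ
  have hXeq : (fun ω => ∫ s in t..(t + δ), Δ s ω)
      = fun ω => ∫ s in Ioc t (t + δ), D s ω := by
    funext ω
    rw [intervalIntegral.integral_of_le htt]
    exact setIntegral_congr_fun measurableSet_Ioc fun s hs => by simp only [hDΔ (hs.2.trans htδ)]
  have hDt1 : Integrable (Function.uncurry D) ((volume.restrict (Ioc t (t + δ))).prod P) :=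
    hDt.integrable one_le_two
  rw [hXeq]
  refine condExp_nonpos_of_forall_setIntegral_nonpos (ℱ.le t) hDt1.integral_prod_right
    fun A hA => ?_
  have hle : (volume.restrict (Ioc t (t + δ))).prod (P.restrict A)
      ≤ (volume.restrict (Ioc t (t + δ))).prod P :=
    Measure.prod_mono le_rfl Measure.restrict_le_self
  have hAm := ℱ.le t A hA
  have hint1 := hDt1.mono_measure hle
  have hint2 := hDt.integrable_sq.mono_measure hle
  have hsymm := integral_prod_symm _ hint1
  simp only [Function.uncurry_apply_pair] at hsymm
  rw [← hsymm]
  have hε (ε : ℝ) (hε : 0 < ε) :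
      ∫ z, Function.uncurry D z ∂(volume.restrict (Ioc t (t + δ))).prod (P.restrict A)
        ≤ ε * ∫ z, Function.uncurry D z ^ 2
          ∂(volume.restrict (Ioc t (t + δ))).prod (P.restrict A) := by
    set f : ℝ × Ω → ℝ := fun z => Function.uncurry D z - ε * Function.uncurry D z ^ 2 with hf
    have hfint : IntegrableOn f (Ioc t (t + δ) ×ˢ A) (volume.prod P) := by
      rw [IntegrableOn, ← Measure.prod_restrict]
      exact hint1.sub (hint2.const_mul ε)
    have hmain : ∫ z in Ioc t (t + δ) ×ˢ A, f z ∂volume.prod P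
        ≤ ∫ z in Ioc t t ×ˢ A, f z ∂volume.prod P := by
      refine le_of_forall_sub_le_mul_sq (φ := fun x => ∫ z in Ioc t x ×ˢ A, f z ∂volume.prod P)
        (K := C₀ * (1 + T) / (4 * ε)) htt fun a b hta hab hbt => ?_
      have ha : 0 ≤ a := ht.trans hta
      have hb : b ≤ T := hbt.trans htδ
      have hsplit : ∫ z in Ioc t b ×ˢ A, f z ∂volume.prod P
          = ∫ z in Ioc t a ×ˢ A, f z ∂volume.prod P
            + ∫ z in Ioc a b ×ˢ A, f z ∂volume.prod P := by
        rw [← Ioc_union_Ioc_eq_Ioc hta hab, union_prod]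
        refine setIntegral_union ?_ (measurableSet_Ioc.prod hAm) (hfint.mono_set ?_)
          (hfint.mono_set ?_)
        · exact Disjoint.set_prod_left (Ioc_disjoint_Ioc_of_le le_rfl) _ _
        · exact prod_mono (Ioc_subset_Ioc_right (hab.trans hbt)) subset_rfl
        · exact prod_mono (Ioc_subset_Ioc hta hbt) subset_rfl
      obtain ⟨ξ, hξm, hξint, hξclose, hξneg⟩ := hξ a b ha hab hb
      have hξL2 : MemLp (Function.uncurry ξ) 2 ((volume.restrict (Ioc a b)).prod P) :=
        (memLp_two_uncurry_of_lintegral_lt_top hξm hξint).mono_measure <| Measure.prod_mono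
          (Measure.restrict_mono Ioc_subset_Icc_self le_rfl) le_rfl
      have hneg : ∀ᵐ ω ∂P, (P[fun ω' => ∫ s in a..b, ξ s ω' * D s ω'|ℱ a]) ω ≤ 0 := by
        have heq : (fun ω' => ∫ s in a..b, ξ s ω' * Δ s ω')
            = fun ω' => ∫ s in a..b, ξ s ω' * D s ω' := by
          funext ω
          refine intervalIntegral.integral_congr fun s hs => ?_
          rw [uIcc_of_le hab] at hs
          simp only [hDΔ (hs.2.trans hb)]
        rwa [heq] at hξneg
      have hclose : ∀ s ∈ Ioc a b, ∀ᵐ ω ∂P,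
          (P[fun ω' => (ξ s ω' - 1) ^ 2|ℱ a]) ω ≤ C₀ * (1 + T) * (s - a) := by
        intro s hs
        filter_upwards [hξclose s (Ioc_subset_Icc_self hs)] with ω hω
        refine hω.trans ?_
        rw [mul_assoc]
        have h1 : 0 ≤ s - a := by linarith [hs.1]
        have h2 : s - a ≤ T := by linarith [hs.2]
        exact mul_le_mul_of_nonneg_left (by nlinarith) hC₀
      have hstep := integral_sub_mul_sq_le (ℱ.le a) hab (mul_nonneg hC₀ (by linarith)) hε
        (hDsub ha hb) hξL2 hclose hneg (ℱ.mono hta A hA)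
      rw [Measure.prod_restrict] at hstep
      simp only [hsplit, add_sub_cancel_left]
      exact hstep
    rw [Ioc_self, empty_prod, Measure.restrict_empty, integral_zero_measure,
      ← Measure.prod_restrict, integral_sub hint1 (hint2.const_mul ε), integral_const_mul] at hmain
    linarith
  have hlim : Filter.Tendsto (fun ε : ℝ => ε * ∫ z, Function.uncurry D z ^ 2
      ∂(volume.restrict (Ioc t (t + δ))).prod (P.restrict A)) (nhdsWithin 0 (Ioi 0)) (nhds 0) := by
    refine Filter.Tendsto.mono_left ?_ nhdsWithin_le_nhds
    exact (continuous_mul_const _).tendsto' 0 0 (zero_mul _)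
  exact ge_of_tendsto hlim (Filter.eventually_of_mem self_mem_nhdsWithin hε)
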